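/- arXiv:cs/0408039 — 2 statements merged into one kernel-verified Lean document; each statement's English description precedes it below -/
import Mathlib

section
/- Let a q-digest with total count n and compression parameter k satisfy digest property (1) and summarize a multiset S of n values from [1,σ], and set ε = (log₂ σ)/k. Given a value x ∈ [1,σ], the inverse quantile algorithm reports r = Σ count(w) over all nodes w in the support with w.max < x. Then r differs from the true rank of x in S (the number of elements of S that are less than x) by at most εn; in particular r ≤ rank(x) ≤ r + εn. -/
open scoped Classical

namespace QDigest

/-- The node set of the complete binary tree `T` over the value range `[1, σ]`,
heap-indexed by `1, …, 2σ − 1`. -/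
def nodes (σ : ℕ) : Finset ℕ := Finset.Icc 1 (2 * σ - 1)

/-- Total count `n` of a q-digest `count`. -/
def total (σ : ℕ) (count : ℕ → ℕ) : ℕ := ∑ v ∈ nodes σ, count v

/-- Parent of a non-root node `v`. -/
def parent (v : ℕ) : ℕ := v / 2

/-- Sibling of a non-root node `v` (the other child of its parent);
maps the root `1` to the non-node `0`. -/
def sibling (v : ℕ) : ℕ := if v % 2 = 0 then v + 1 else v - 1

/-- Support (node set `Q`) of a q-digest. -/
def support (σ : ℕ) (count : ℕ → ℕ) : Finset ℕ :=
  (nodes σ).filter fun v => count v ≠ 0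

/-- `u` is an ancestor of, or equal to, `v` in the heap-indexed tree. -/
def AncOrEq (u v : ℕ) : Prop := ∃ i : ℕ, v / 2 ^ i = u

/-- The leaf corresponding to the value `x ∈ [1, σ]`. -/
def leafOf (σ x : ℕ) : ℕ := σ - 1 + x

/-- Sum of the counts over the proper ancestors of `v`. -/
def ancSum (count : ℕ → ℕ) (v : ℕ) : ℕ :=
  ∑ j ∈ Finset.Icc 1 (Nat.log 2 v), count (v / 2 ^ j)

/-- Width of the dyadic interval `range(v)` of node `v`. -/
def width (σ v : ℕ) : ℕ := σ / 2 ^ Nat.log 2 v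

/-- Right endpoint `v.max` of the dyadic interval of node `v`. -/
def vmax (σ v : ℕ) : ℕ := (v + 1) * width σ v - σ

/-- Left endpoint `v.min` of the dyadic interval of node `v`. -/
def vmin (σ v : ℕ) : ℕ := v * width σ v - σ + 1

/-- The q-digest `count` summarizes the multiset `S` of values from `[1, σ]`:
there is an assignment sending each element `x` of `S` to a node of `T` that is
an ancestor of (or equal to) the leaf corresponding to `x`, such that `count v`
is the number of elements assigned to `v`. -/
def Summarizes (σ : ℕ) (count : ℕ → ℕ) (S : Multiset ℕ) : Prop :=
  ∃ P : Multiset (ℕ × ℕ),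
    P.map Prod.fst = S ∧
    (∀ p ∈ P, p.2 ∈ nodes σ ∧ AncOrEq p.2 (leafOf σ p.1)) ∧
    ∀ v : ℕ, count v = Multiset.card (P.filter fun p => p.2 = v)

/-- `true(v)`: the number of elements of `S` lying in `range(v)`. -/
noncomputable def trueCount (σ : ℕ) (S : Multiset ℕ) (v : ℕ) : ℕ :=
  Multiset.card (S.filter fun x => AncOrEq v (leafOf σ x))

/-- `sub(v)`: sum of the counts over the subtree of `T` rooted at `v`. -/
noncomputable def subSum (σ : ℕ) (count : ℕ → ℕ) (v : ℕ) : ℕ :=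
  ∑ u ∈ (nodes σ).filter (fun u => AncOrEq v u), count u

/-- `u` precedes `v`, or equals it, in the post-order of `T`: increasing right
endpoint `v.max`, ties broken by placing smaller intervals first. -/
def postLE (σ u v : ℕ) : Prop :=
  vmax σ u < vmax σ v ∨ (vmax σ u = vmax σ v ∧ width σ u ≤ width σ v)

/-- One step of COMPRESS at the sibling pair whose parent is `u`: if digest
property (2) fails for the pair, its counts are added to the parent and zeroed. -/
def compressStep (nk : ℕ) (count : ℕ → ℕ) (u : ℕ) : ℕ → ℕ :=
  if count (2 * u) + count (2 * u + 1) + count u ≤ nk then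
    fun w =>
      if w = u then count u + count (2 * u) + count (2 * u + 1)
      else if w = 2 * u ∨ w = 2 * u + 1 then 0 else count w
  else count

/-- COMPRESS(Q, n, k): process sibling pairs level by level from the leaves
upward, i.e. parents `σ - 1, σ - 2, …, 1`. -/
def compress (σ n k : ℕ) (count : ℕ → ℕ) : ℕ → ℕ :=
  (((List.range (σ - 1)).reverse).map (· + 1)).foldl
    (fun c u => compressStep (n / k) c u) count

/-- Post-order traversal of the subtree rooted at `v` (with recursion fuel). -/
def postorderAux (σ : ℕ) : ℕ → ℕ → List ℕ
  | 0, v => [v]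
  | fuel + 1, v =>
      if σ ≤ v then [v]
      else postorderAux σ fuel (2 * v) ++ postorderAux σ fuel (2 * v + 1) ++ [v]

/-- Post-order traversal of the complete binary tree over `[1, σ]`, `σ = 2 ^ h`. -/
def postorder (σ h : ℕ) : List ℕ := postorderAux σ h 1

end QDigest

open QDigest

namespace QDigest

/-- The total count over a set of nodes is the number of elements assigned to it. -/
theorem sum_card_filter_snd_eq (P : Multiset (ℕ × ℕ)) (A : Finset ℕ) :
    ∑ w ∈ A, Multiset.card (P.filter fun p => p.2 = w)
      = Multiset.card (P.filter fun p => p.2 ∈ A) := by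
  induction P using Multiset.induction_on with
  | empty => simp
  | cons p P ih =>
    simp only [Multiset.filter_cons, Multiset.card_add, Finset.sum_add_distrib, ih]
    congr 1
    simp only [apply_ite Multiset.card, Multiset.card_singleton, Multiset.card_zero,
      Finset.sum_ite_eq]

theorem card_filter_le_card_filter_of_imp {α : Type*} (P : Multiset α) (p q : α → Prop)
    [DecidablePred p] [DecidablePred q] (hpq : ∀ a ∈ P, p a → q a) :
    Multiset.card (P.filter p) ≤ Multiset.card (P.filter q) := by
  have hle : P.filter p ≤ P.filter q := by
    rw [Multiset.le_filter]
    refine ⟨Multiset.filter_le _ _, fun a ha => ?_⟩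
    rw [Multiset.mem_filter] at ha
    exact hpq a ha.1 ha.2
  exact Multiset.card_le_card hle

theorem le_of_div_two_pow_pos {h L i : ℕ} (hlt : L < 2 ^ (h + 1)) (hw : 1 ≤ L / 2 ^ i) :
    i ≤ h := by
  have hpow : 2 ^ i ≤ L := by
    by_contra hc
    rw [Nat.div_eq_of_lt (not_le.mp hc)] at hw
    omega
  have := (Nat.pow_lt_pow_iff_right (by norm_num : 1 < 2)).mp (hpow.trans_lt hlt)
  omega

/-- The ancestor at height `i` of a leaf covers an interval of width `2 ^ i`. -/
theorem width_div_two_pow {h L i : ℕ} (hle : 2 ^ h ≤ L) (hlt : L < 2 ^ (h + 1)) (hi : i ≤ h) :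
    width (2 ^ h) (L / 2 ^ i) = 2 ^ i := by
  have hlog : Nat.log 2 L = h := Nat.log_eq_of_pow_le_of_lt_pow hle hlt
  have hlogw : Nat.log 2 (L / 2 ^ i) = h - i := by
    rw [Nat.log_div_base_pow, hlog]
  rw [width, hlogw, Nat.pow_div (Nat.sub_le h i) (by norm_num)]
  congr 1
  omega

theorem le_vmax_of_ancOrEq {h y w : ℕ} (hy : y ∈ Finset.Icc 1 (2 ^ h)) (hw : w ∈ nodes (2 ^ h))
    (hanc : AncOrEq w (leafOf (2 ^ h) y)) : y ≤ vmax (2 ^ h) w := by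
  obtain ⟨i, rfl⟩ := hanc
  rw [Finset.mem_Icc] at hy
  rw [nodes, Finset.mem_Icc] at hw
  have hpow : 2 ^ (h + 1) = 2 * 2 ^ h := by ring
  have hlt : leafOf (2 ^ h) y < 2 ^ (h + 1) := by unfold leafOf; omega
  have hle : 2 ^ h ≤ leafOf (2 ^ h) y := by unfold leafOf; omega
  rw [vmax, width_div_two_pow hle hlt (le_of_div_two_pow_pos hlt hw.1)]
  have hcover := Nat.lt_mul_of_div_lt (Nat.lt_succ_self (leafOf (2 ^ h) y / 2 ^ i))
    (pow_pos two_pos i)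
  rw [Nat.succ_eq_add_one] at hcover
  generalize (leafOf (2 ^ h) y / 2 ^ i + 1) * 2 ^ i = m at *
  unfold leafOf at *
  omega

/-- A node holding a value `y < x` whose interval reaches `x` is a proper ancestor of the
leaf of `x`. -/
theorem exists_div_two_pow_eq_of_lt_of_le_vmax {h x y w : ℕ}
    (hy : y ∈ Finset.Icc 1 (2 ^ h)) (hw : w ∈ nodes (2 ^ h))
    (hanc : AncOrEq w (leafOf (2 ^ h) y)) (hyx : y < x) (hxw : x ≤ vmax (2 ^ h) w) :
    ∃ i ∈ Finset.Icc 1 h, leafOf (2 ^ h) x / 2 ^ i = w := by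
  obtain ⟨i, rfl⟩ := hanc
  rw [Finset.mem_Icc] at hy
  rw [nodes, Finset.mem_Icc] at hw
  have hpow : 2 ^ (h + 1) = 2 * 2 ^ h := by ring
  have hlt : leafOf (2 ^ h) y < 2 ^ (h + 1) := by unfold leafOf; omega
  have hle : 2 ^ h ≤ leafOf (2 ^ h) y := by unfold leafOf; omega
  have hi := le_of_div_two_pow_pos hlt hw.1
  rw [vmax, width_div_two_pow hle hlt hi] at hxw
  have hlower : leafOf (2 ^ h) y / 2 ^ i ≤ leafOf (2 ^ h) x / 2 ^ i :=
    Nat.div_le_div_right (by unfold leafOf; omega)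
  have hupper : leafOf (2 ^ h) x / 2 ^ i < leafOf (2 ^ h) y / 2 ^ i + 1 := by
    rw [Nat.div_lt_iff_lt_mul (pow_pos two_pos i)]
    generalize (leafOf (2 ^ h) y / 2 ^ i + 1) * 2 ^ i = m at *
    unfold leafOf
    omega
  have heq : leafOf (2 ^ h) x / 2 ^ i = leafOf (2 ^ h) y / 2 ^ i := by omega
  refine ⟨i, Finset.mem_Icc.mpr ⟨?_, hi⟩, heq⟩
  rcases Nat.eq_zero_or_pos i with rfl | hpos
  · simp only [pow_zero, Nat.div_one] at heq
    unfold leafOf at heq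
    omega
  · exact hpos

theorem leafOf_div_two_pow_lt {h x i : ℕ} (hx : x ∈ Finset.Icc 1 (2 ^ h)) (hi : 1 ≤ i) :
    leafOf (2 ^ h) x / 2 ^ i < 2 ^ h := by
  rw [Finset.mem_Icc] at hx
  have hle : leafOf (2 ^ h) x / 2 ^ i ≤ leafOf (2 ^ h) x / 2 ^ 1 :=
    Nat.div_le_div_left (Nat.pow_le_pow_right two_pos hi) (by norm_num)
  unfold leafOf at *
  omega

end QDigest

/-- let a q-digest (total count `n`, compression parameter `k`)
satisfy digest property (1) and summarize a multiset `S` of `n` values from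
`[1, σ]`, and set `ε = log₂(σ)/k`. For a value `x ∈ [1, σ]`, the inverse
quantile algorithm reports `r = Σ count(w)` over the support nodes `w` with
`w.max < x`; then `r ≤ rank(x) ≤ r + ε·n`, where `rank(x)` is the number of
elements of `S` less than `x`. -/
theorem inverse_quantile_bounds
    (h σ : ℕ) (hh : 1 ≤ h) (hσ : σ = 2 ^ h)
    (count : ℕ → ℕ) (hsupp : ∀ v, count v ≠ 0 → v ∈ nodes σ)
    (S : Multiset ℕ) (hS : ∀ x ∈ S, x ∈ Finset.Icc 1 σ)
    (n k : ℕ) (hcard : Multiset.card S = n) (hn : total σ count = n) (hk : 1 ≤ k)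
    (hsum : Summarizes σ count S)
    (hprop1 : ∀ v ∈ support σ count, v < σ → count v ≤ n / k)
    (x : ℕ) (hx : x ∈ Finset.Icc 1 σ) :
    (∑ w ∈ (support σ count).filter (fun w => vmax σ w < x), count w)
        ≤ Multiset.card (S.filter fun y => y < x) ∧
    (Multiset.card (S.filter fun y => y < x) : ℝ)
        ≤ ((∑ w ∈ (support σ count).filter (fun w => vmax σ w < x), count w : ℕ) : ℝ)
          + ((Nat.log 2 σ : ℝ) / (k : ℝ)) * (n : ℝ) := by
  subst hσ
  obtain ⟨P, rfl, hP, hcount⟩ := hsum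
  have hval : ∀ p ∈ P, p.1 ∈ Finset.Icc 1 (2 ^ h) := fun p hp =>
    hS p.1 (Multiset.mem_map_of_mem _ hp)
  have hmem : ∀ p ∈ P, p.2 ∈ support (2 ^ h) count := by
    intro p hp
    refine Finset.mem_filter.mpr ⟨(hP p hp).1, ?_⟩
    rw [hcount]
    have hfilter : p ∈ P.filter fun q => q.2 = p.2 := Multiset.mem_filter.mpr ⟨hp, rfl⟩
    exact (Multiset.card_pos_iff_exists_mem.mpr ⟨p, hfilter⟩).ne'
  have hsumcount : ∀ A : Finset ℕ,
      ∑ w ∈ A, count w = Multiset.card (P.filter fun p => p.2 ∈ A) := by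
    intro A
    rw [← sum_card_filter_snd_eq]
    exact Finset.sum_congr rfl fun w _ => hcount w
  have hrank : Multiset.card ((P.map Prod.fst).filter fun y => y < x)
      = Multiset.card (P.filter fun p => p.1 < x) := by
    rw [Multiset.filter_map, Multiset.card_map]
    rfl
  rw [hrank]
  set F := (support (2 ^ h) count).filter (fun w => vmax (2 ^ h) w < x)
  constructor
  · rw [hsumcount]
    refine card_filter_le_card_filter_of_imp _ _ _ fun p hp hpF => ?_
    exact (le_vmax_of_ancOrEq (hval p hp) (hP p hp).1 (hP p hp).2).trans_lt
      (Finset.mem_filter.mp hpF).2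
  · set A := (Finset.Icc 1 h).image fun i => leafOf (2 ^ h) x / 2 ^ i
    have hcover : Multiset.card (P.filter fun p => p.1 < x)
        ≤ ∑ w ∈ F, count w + ∑ w ∈ A, count w := by
      refine le_trans ?_ (Finset.sum_union_inter (s₁ := F) (s₂ := A) (f := count)).le
      refine le_trans ?_ (Nat.le_add_right _ _)
      rw [hsumcount]
      refine card_filter_le_card_filter_of_imp _ _ _ fun p hp hpx => ?_
      rw [Finset.mem_union]
      by_cases hmax : vmax (2 ^ h) p.2 < x
      · exact Or.inl (Finset.mem_filter.mpr ⟨hmem p hp, hmax⟩)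
      · exact Or.inr (Finset.mem_image.mpr (exists_div_two_pow_eq_of_lt_of_le_vmax
          (hval p hp) (hP p hp).1 (hP p hp).2 hpx (not_lt.mp hmax)))
    have hbound : ∑ w ∈ A, count w ≤ h * (n / k) := by
      have hAcard : A.card ≤ h := by
        simpa using Finset.card_image_le (s := Finset.Icc 1 h)
          (f := fun i => leafOf (2 ^ h) x / 2 ^ i)
      refine (Finset.sum_le_card_nsmul A count (n / k) fun w hw => ?_).trans ?_
      · obtain ⟨i, hi, rfl⟩ := Finset.mem_image.mp hw
        by_cases hzero : count (leafOf (2 ^ h) x / 2 ^ i) = 0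
        · simp [hzero]
        · exact hprop1 _ (Finset.mem_filter.mpr ⟨hsupp _ hzero, hzero⟩)
            (leafOf_div_two_pow_lt hx (Finset.mem_Icc.mp hi).1)
      · rw [smul_eq_mul]
        exact Nat.mul_le_mul_right _ hAcard
    have hreal : (Multiset.card (P.filter fun p => p.1 < x) : ℝ)
        ≤ ((∑ w ∈ F, count w : ℕ) : ℝ) + (h : ℝ) * ((n / k : ℕ) : ℝ) := by
      exact_mod_cast hcover.trans (Nat.add_le_add_left hbound _)
    have hdiv : ((n / k : ℕ) : ℝ) ≤ (n : ℝ) / k := Nat.cast_div_le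
    rw [Nat.log_pow (by norm_num : 1 < 2), div_mul_eq_mul_div, mul_div_assoc]
    exact hreal.trans (by gcongr)
end

section
/- Let a q-digest with total count n and compression parameter k satisfy digest property (1) and summarize a multiset S of n values from [1,σ], and set ε = (log₂ σ)/k. Given 1 ≤ low ≤ high ≤ σ, the range-query estimate is the difference of the two inverse-quantile answers at the endpoints, i.e. r(high+1) − r(low) where r(x) = Σ count(w) over nodes w in the support with w.max < x. Then this estimate differs from the true number of elements of S lying in [low, high] by at most 2εn. -/
open scoped Classical

open QDigest

namespace QDigest

theorem card_filter_snd_mem {α β : Type*} [DecidableEq β] (P : Multiset (α × β)) (A : Finset β) :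
    Multiset.card (P.filter fun p => p.2 ∈ A)
      = ∑ v ∈ A, Multiset.card (P.filter fun p => p.2 = v) := by
  induction P using Multiset.induction_on with
  | empty => simp
  | cons p P ih =>
    simp only [← Multiset.countP_eq_card_filter, Multiset.countP_cons] at ih ⊢
    rw [Finset.sum_add_distrib, ih, Finset.sum_ite_eq]

theorem log_leafOf {h y : ℕ} (hy : y ∈ Finset.Icc 1 (2 ^ h)) :
    Nat.log 2 (leafOf (2 ^ h) y) = h := by
  rw [Finset.mem_Icc] at hy
  have hpos : 0 < 2 ^ h := by positivity
  apply Nat.log_eq_of_pow_le_of_lt_pow <;> unfold leafOf <;> omega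

/-- The ancestor `i` levels above a leaf is a node only for `i ≤ h`. -/
theorem le_height_of_leafOf_div_pos {h y i : ℕ} (hy : y ∈ Finset.Icc 1 (2 ^ h))
    (hpos : 0 < leafOf (2 ^ h) y / 2 ^ i) : i ≤ h := by
  rw [← log_leafOf hy]
  have hle : 2 ^ i ≤ leafOf (2 ^ h) y := (Nat.div_pos_iff.mp hpos).2
  exact Nat.le_log_of_pow_le (by norm_num) hle

theorem width_leafOf_div {h y i : ℕ} (hy : y ∈ Finset.Icc 1 (2 ^ h)) (hi : i ≤ h) :
    width (2 ^ h) (leafOf (2 ^ h) y / 2 ^ i) = 2 ^ i := by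
  have hlog : Nat.log 2 (leafOf (2 ^ h) y / 2 ^ i) = h - i := by
    rw [Nat.log_div_base_pow, log_leafOf hy]
  rw [width, hlog, Nat.pow_div (Nat.sub_le h i) (by norm_num), Nat.sub_sub_self hi]

theorem le_vmax {h y u : ℕ} (hy : y ∈ Finset.Icc 1 (2 ^ h)) (hu : 0 < u)
    (hanc : AncOrEq u (leafOf (2 ^ h) y)) : y ≤ vmax (2 ^ h) u := by
  obtain ⟨i, rfl⟩ := hanc
  rw [vmax, width_leafOf_div hy (le_height_of_leafOf_div_pos hy hu)]
  have hlt : leafOf (2 ^ h) y < (leafOf (2 ^ h) y / 2 ^ i + 1) * 2 ^ i :=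
    Nat.lt_mul_of_div_lt (Nat.lt_succ_self _) (by positivity)
  have hpos : 0 < 2 ^ h := by positivity
  unfold leafOf at hlt ⊢
  omega

/-- The internal nodes that are proper ancestors of the leaf of `x`. -/
def properAncestors (h x : ℕ) : Finset ℕ :=
  ((Finset.Icc 1 h).image fun j => leafOf (2 ^ h) x / 2 ^ j).filter (· < 2 ^ h)

theorem card_properAncestors_le (h x : ℕ) : (properAncestors h x).card ≤ h :=
  (Finset.card_filter_le _ _).trans (Finset.card_image_le.trans (by simp))

/-- A node whose interval contains `y` and extends to some `x > y` is a proper ancestor of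
the leaf of `x`. -/
theorem mem_properAncestors {h x y u : ℕ} (hy : y ∈ Finset.Icc 1 (2 ^ h)) (hu : 0 < u)
    (hanc : AncOrEq u (leafOf (2 ^ h) y)) (hyx : y < x) (hx : x ≤ vmax (2 ^ h) u) :
    u ∈ properAncestors h x := by
  obtain ⟨i, rfl⟩ := hanc
  have hih := le_height_of_leafOf_div_pos hy hu
  rw [vmax, width_leafOf_div hy hih] at hx
  have hpos : 0 < 2 ^ h := by positivity
  have hy' := Finset.mem_Icc.mp hy
  have hi : 1 ≤ i := by
    by_contra hi
    obtain rfl : i = 0 := by omega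
    simp only [leafOf, pow_zero, Nat.div_one, mul_one] at hx
    omega
  have hge : leafOf (2 ^ h) y / 2 ^ i * 2 ^ i ≤ leafOf (2 ^ h) y := Nat.div_mul_le_self _ _
  have hdiv : leafOf (2 ^ h) x / 2 ^ i = leafOf (2 ^ h) y / 2 ^ i := by
    apply Nat.div_eq_of_lt_le
    · refine hge.trans ?_
      unfold leafOf
      omega
    · generalize (leafOf (2 ^ h) y / 2 ^ i + 1) * 2 ^ i = m at hx ⊢
      unfold leafOf
      omega
  refine Finset.mem_filter.mpr ⟨Finset.mem_image.mpr ⟨i, Finset.mem_Icc.mpr ⟨hi, hih⟩, hdiv⟩, ?_⟩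
  have hhalf : leafOf (2 ^ h) y / 2 ^ i ≤ leafOf (2 ^ h) y / 2 ^ 1 :=
    Nat.div_le_div_left (Nat.pow_le_pow_right (by norm_num) hi) (by norm_num)
  refine hhalf.trans_lt ?_
  unfold leafOf
  omega

/-- The inverse-quantile answer at `x` undershoots the rank of `x` by at most `h * m`, where `m`
bounds the counts of internal nodes. -/
theorem inverse_quantile_bound {h : ℕ} {count : ℕ → ℕ} {S : Multiset ℕ} {m : ℕ}
    (hsupp : ∀ v, count v ≠ 0 → v ∈ nodes (2 ^ h))
    (hS : ∀ y ∈ S, y ∈ Finset.Icc 1 (2 ^ h)) (hsum : Summarizes (2 ^ h) count S)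
    (hprop1 : ∀ v ∈ support (2 ^ h) count, v < 2 ^ h → count v ≤ m) (x : ℕ) :
    ∑ w ∈ (support (2 ^ h) count).filter (fun w => vmax (2 ^ h) w < x), count w
        ≤ Multiset.card (S.filter (· < x)) ∧
      Multiset.card (S.filter (· < x))
        ≤ ∑ w ∈ (support (2 ^ h) count).filter (fun w => vmax (2 ^ h) w < x), count w
          + h * m := by
  obtain ⟨P, rfl, hP, hcount⟩ := hsum
  have hval : ∀ p ∈ P, p.1 ∈ Finset.Icc 1 (2 ^ h) := fun p hp =>
    hS _ (Multiset.mem_map_of_mem _ hp)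
  have hnode : ∀ p ∈ P, 0 < p.2 := fun p hp => (Finset.mem_Icc.mp (hP p hp).1).1
  have hmem : ∀ p ∈ P, p.2 ∈ support (2 ^ h) count := fun p hp => by
    refine Finset.mem_filter.mpr ⟨(hP p hp).1, ?_⟩
    rw [hcount, ← Nat.pos_iff_ne_zero, Multiset.card_pos_iff_exists_mem]
    exact ⟨p, Multiset.mem_filter.mpr ⟨hp, rfl⟩⟩
  have hsumcard : ∀ A : Finset ℕ,
      ∑ w ∈ A, count w = Multiset.card (P.filter fun p => p.2 ∈ A) := fun A => by
    simp only [card_filter_snd_mem, hcount]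
  have hrank : Multiset.card ((P.map Prod.fst).filter (· < x))
      = Multiset.card (P.filter fun p => p.1 < x) := by
    rw [Multiset.filter_map, Multiset.card_map]
    rfl
  rw [hrank]
  constructor
  · rw [hsumcard]
    refine Multiset.card_le_card (Multiset.le_filter.mpr ⟨Multiset.filter_le _ _, ?_⟩)
    intro p hp
    rw [Multiset.mem_filter, Finset.mem_filter] at hp
    exact (le_vmax (hval p hp.1) (hnode p hp.1) (hP p hp.1).2).trans_lt hp.2.2
  · have hanc : ∑ w ∈ properAncestors h x, count w ≤ h * m := by
      refine (Finset.sum_le_card_nsmul _ _ m ?_).trans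
        (Nat.mul_le_mul_right m (card_properAncestors_le h x))
      intro v hv
      by_cases hv0 : count v = 0
      · omega
      · exact hprop1 v (Finset.mem_filter.mpr ⟨hsupp v hv0, hv0⟩) (Finset.mem_filter.mp hv).2
    refine le_trans ?_ (Nat.add_le_add_left hanc _)
    rw [hsumcard, hsumcard, ← Multiset.card_add, Multiset.filter_add_filter, Multiset.card_add]
    refine le_trans (Multiset.card_le_card ?_) (Nat.le_add_right _ _)
    refine Multiset.le_filter.mpr ⟨Multiset.filter_le _ _, ?_⟩
    intro p hp
    rw [Multiset.mem_filter] at hp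
    rcases lt_or_ge (vmax (2 ^ h) p.2) x with hlt | hge
    · exact Or.inl (Finset.mem_filter.mpr ⟨hmem p hp.1, hlt⟩)
    · exact Or.inr
        (mem_properAncestors (hval p hp.1) (hnode p hp.1) (hP p hp.1).2 hp.2 hge)

/-- Counting in `[low, high]` is a difference of ranks. -/
theorem card_filter_Icc_add {low high : ℕ} (S : Multiset ℕ) (hlh : low ≤ high) :
    Multiset.card (S.filter fun x => low ≤ x ∧ x ≤ high) + Multiset.card (S.filter (· < low))
      = Multiset.card (S.filter (· < high + 1)) := by
  induction S using Multiset.induction_on with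
  | empty => simp
  | cons y S ih =>
    simp only [← Multiset.countP_eq_card_filter, Multiset.countP_cons] at ih ⊢
    split_ifs <;> omega

end QDigest

/-- let a q-digest (total count `n`, compression parameter `k`)
satisfy digest property (1) and summarize a multiset `S` of `n` values from
`[1, σ]`, and set `ε = log₂(σ)/k`. For `1 ≤ low ≤ high ≤ σ`, the range-query
estimate `r(high+1) − r(low)` (where `r(x)` is the inverse-quantile answer
`Σ count(w)` over support nodes `w` with `w.max < x`) differs from the true
number of elements of `S` in `[low, high]` by at most `2·ε·n`. -/
theorem range_query_bound
    (h σ : ℕ) (hh : 1 ≤ h) (hσ : σ = 2 ^ h)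
    (count : ℕ → ℕ) (hsupp : ∀ v, count v ≠ 0 → v ∈ nodes σ)
    (S : Multiset ℕ) (hS : ∀ x ∈ S, x ∈ Finset.Icc 1 σ)
    (n k : ℕ) (hcard : Multiset.card S = n) (hn : total σ count = n) (hk : 1 ≤ k)
    (hsum : Summarizes σ count S)
    (hprop1 : ∀ v ∈ support σ count, v < σ → count v ≤ n / k)
    (low high : ℕ) (hlow : 1 ≤ low) (hlh : low ≤ high) (hhigh : high ≤ σ) :
    |(((∑ w ∈ (support σ count).filter (fun w => vmax σ w < high + 1), count w : ℕ) : ℝ)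
        - ((∑ w ∈ (support σ count).filter (fun w => vmax σ w < low), count w : ℕ) : ℝ))
      - (Multiset.card (S.filter fun x => low ≤ x ∧ x ≤ high) : ℝ)|
      ≤ 2 * (((Nat.log 2 σ : ℝ) / (k : ℝ)) * (n : ℝ)) := by
  subst hσ
  have hhi := inverse_quantile_bound hsupp hS hsum hprop1 (high + 1)
  have hlo := inverse_quantile_bound hsupp hS hsum hprop1 low
  have hrange := card_filter_Icc_add S hlh
  generalize ∑ w ∈ (support (2 ^ h) count).filter (fun w => vmax (2 ^ h) w < high + 1), count w
    = a at hhi ⊢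
  generalize ∑ w ∈ (support (2 ^ h) count).filter (fun w => vmax (2 ^ h) w < low), count w
    = b at hlo ⊢
  generalize Multiset.card (S.filter fun x => low ≤ x ∧ x ≤ high) = c at hrange ⊢
  rw [Nat.log_pow (by norm_num)]
  have herr : ((h * (n / k) : ℕ) : ℝ) ≤ (h : ℝ) / k * n := by
    rw [Nat.cast_mul, div_mul_eq_mul_div, mul_div_assoc]
    exact mul_le_mul_of_nonneg_left Nat.cast_div_le (Nat.cast_nonneg h)
  have hupper : a ≤ b + c + h * (n / k) := by omega
  have hlower : b + c ≤ a + h * (n / k) := by omega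
  have hupper' : (a : ℝ) ≤ b + c + (h * (n / k) : ℕ) := by exact_mod_cast hupper
  have hlower' : (b : ℝ) + c ≤ a + (h * (n / k) : ℕ) := by exact_mod_cast hlower
  have hnonneg : (0 : ℝ) ≤ (h * (n / k) : ℕ) := Nat.cast_nonneg _
  rw [abs_le]
  constructor <;> linarith
end
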